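/- arXiv:2012.13027 — 2 statements merged into one kernel-verified Lean document; each statement's English description precedes it below -/
import Mathlib

section
/- Pathwise (for every realization of the observation sequence): for every u ≥ 0, t_I ≤ t_S^{(u)} + t_I^{t_S^{(u)}+1}, and for every k with t_S^{(u)} < k ≤ t_S^{(u+1)}, t_S^{(u+1)} ≤ k + t_S^k − 1. Consequently, for u* = inf{u : t_S^{(u)} ≥ t_1}, t_I ≤ t_1 − 1 + t_S^{t_1} + t_I^{t_S^{(u*)}+1}. -/
open MeasureTheory ProbabilityTheory Finset
open scoped ENNReal ENat Classical

noncomputable section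

namespace QCD

/-- `p` is a probability mass function on the finite type `B`. -/
def IsPmf {B : Type*} [Fintype B] (p : B → ℝ) : Prop :=
  (∀ a, 0 ≤ p a) ∧ ∑ a, p a = 1

/-- The measure on a finite type induced by a pmf `f`. -/
def pmfMeasure {B : Type*} [Fintype B] [MeasurableSpace B] (f : B → ℝ) : Measure B :=
  ∑ a : B, (ENNReal.ofReal (f a)) • Measure.dirac a

/-- Kullback-Leibler divergence `I(f‖g) = Σ_a f a * log (f a / g a)` (in nats), with the
convention `0 * log 0 = 0`. -/
def klReal {B : Type*} [Fintype B] (f g : B → ℝ) : ℝ :=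
  ∑ a, f a * Real.log (f a / g a)

variable {J : ℕ} {A : Fin J → Type*} [∀ j, Fintype (A j)] [∀ j, DecidableEq (A j)]
variable {Ω : Type*}

/-- The `j`-th marginal of a joint pmf on the product alphabet `∀ j, A j`. -/
def marginal (f : (∀ j, A j) → ℝ) (j : Fin J) (a : A j) : ℝ :=
  ∑ x : ∀ j, A j, if x j = a then f x else 0

/-- The global statistic `q(f) = Σ_j q_j(f_j)`. -/
def globalStat (qj : ∀ j, (A j → ℝ) → ℝ) (f : (∀ j, A j) → ℝ) : ℝ :=
  ∑ j, qj j (marginal f j)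

/-- The joint (product) pmf on the product alphabet built from local pmfs. -/
def prodPmf (g : ∀ j, A j → ℝ) : (∀ j, A j) → ℝ :=
  fun x => ∏ j, g j (x j)

/-- Empirical pmf of the observations `X l, …, X k` (a window of `k + 1 - l` samples). -/
def emp (X : ℕ → Ω → ∀ j, A j) (l k : ℕ) (ω : Ω) (a : ∀ j, A j) : ℝ :=
  (∑ k' ∈ Finset.Icc l k, if X k' ω = a then (1 : ℝ) else 0) / ((k + 1 - l : ℕ) : ℝ)

/-- The configuration of the network information projection test: observations `X`,
local statistics `qj`, drift `κ`, first-stage threshold `cS`, second-stage thresholds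
`cD n`, and information projections `fstar n` (the most likely false alarm pmfs). -/
structure Config (J : ℕ) (A : Fin J → Type*) (Ω : Type*) : Type _ where
  X : ℕ → Ω → ∀ j, A j
  qj : ∀ j, (A j → ℝ) → ℝ
  kappa : ℝ
  cS : ℝ
  cD : ℕ → ℝ
  fstar : ℕ → ((∀ j, A j) → ℝ)

/-- CUSUM statistic `max_{t ≤ l ≤ k+1} (k - l + 1)(q(f̂_{X_l^k}) - κ)` given that the
current reset time is `t`. -/
def Sgen (cfg : Config J A Ω) (t k : ℕ) (ω : Ω) : ℝ :=
  (insert (k + 1) (Finset.Icc t (k + 1))).sup' (Finset.insert_nonempty _ _)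
    (fun l => ((k + 1 - l : ℕ) : ℝ) * (globalStat cfg.qj (emp cfg.X l k ω) - cfg.kappa))

/-- The maximizing window start `i_k` in the CUSUM statistic (given reset time `t`);
ties are broken towards the largest maximizer. -/
def igen (cfg : Config J A Ω) (t k : ℕ) (ω : Ω) : ℕ :=
  ((insert (k + 1) (Finset.Icc t (k + 1))).filter
      (fun l => ((k + 1 - l : ℕ) : ℝ) * (globalStat cfg.qj (emp cfg.X l k ω) - cfg.kappa)
          = Sgen cfg t k ω)).max' (by
    obtain ⟨b, hb, hbe⟩ := Finset.exists_mem_eq_sup'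
      (Finset.insert_nonempty (k + 1) (Finset.Icc t (k + 1)))
      (fun l => ((k + 1 - l : ℕ) : ℝ) * (globalStat cfg.qj (emp cfg.X l k ω) - cfg.kappa))
    exact ⟨b, Finset.mem_filter.2 ⟨hb, hbe.symm⟩⟩)

/-- KL divergence `D_k` of the empirical pmf on the maximizing window from the most
likely false alarm pmf, given reset time `t`. -/
def Dgen (cfg : Config J A Ω) (t k : ℕ) (ω : Ω) : ℝ :=
  klReal (emp cfg.X (igen cfg t k ω) k ω) (cfg.fstar (k + 1 - igen cfg t k ω))

/-- Reset times: `τ 1 = 1` and `τ (k+1) = k+1` if `S k ≥ cS` and `D k < cD (n k)`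
(i.e. the alarm at time `k` is suppressed and the algorithm is reset), else `τ k`. -/
def tau (cfg : Config J A Ω) : ℕ → Ω → ℕ
  | 0, _ => 1
  | 1, _ => 1
  | (k + 2), ω =>
    let t := tau cfg (k + 1) ω
    if cfg.cS ≤ Sgen cfg t (k + 1) ω ∧
        Dgen cfg t (k + 1) ω < cfg.cD (k + 2 - igen cfg t (k + 1) ω)
    then k + 2 else t

/-- The CUSUM statistic `S_k`. -/
def Sstat (cfg : Config J A Ω) (k : ℕ) (ω : Ω) : ℝ :=
  Sgen cfg (tau cfg k ω) k ω

/-- The maximizing window start `i_k`. -/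
def istat (cfg : Config J A Ω) (k : ℕ) (ω : Ω) : ℕ :=
  igen cfg (tau cfg k ω) k ω

/-- The maximizing window length `n_k = k - i_k + 1`. -/
def nstat (cfg : Config J A Ω) (k : ℕ) (ω : Ω) : ℕ :=
  k + 1 - istat cfg k ω

/-- The second-stage statistic `D_k = I(f̂_{X_{i_k}^k} ‖ f*_{n_k})`. -/
def Dstat (cfg : Config J A Ω) (k : ℕ) (ω : Ω) : ℝ :=
  klReal (emp cfg.X (istat cfg k ω) k ω) (cfg.fstar (nstat cfg k ω))

/-- First-stage stopping time `t_S = inf {k ≥ 1 : S_k ≥ cS}` (`⊤` if no such `k`). -/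
def tS (cfg : Config J A Ω) (ω : Ω) : ℕ∞ :=
  ⨅ k ∈ {k : ℕ | 1 ≤ k ∧ cfg.cS ≤ Sstat cfg k ω}, (k : ℕ∞)

/-- The network information projection test (NIPT)
`t_I = inf {k ≥ 1 : S_k ≥ cS and D_k ≥ cD (n_k)}` (`⊤` if no such `k`). -/
def tI (cfg : Config J A Ω) (ω : Ω) : ℕ∞ :=
  ⨅ k ∈ {k : ℕ | 1 ≤ k ∧ cfg.cS ≤ Sstat cfg k ω ∧
      cfg.cD (nstat cfg k ω) ≤ Dstat cfg k ω}, (k : ℕ∞)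

/-- The σ-algebra generated by the pre-change samples `X 1, …, X (t₁ - 1)`. -/
def preSigma [∀ j, MeasurableSpace (A j)] (X : ℕ → Ω → ∀ j, A j) (t₁ : ℕ) :
    MeasurableSpace Ω :=
  ⨆ k ∈ Set.Ico 1 t₁, MeasurableSpace.comap (X k) MeasurableSpace.pi

end QCD

namespace QCD

variable {J : ℕ} {A : Fin J → Type*} {Ω : Type*}

/-- The configuration that discards the first `d` observations. -/
def Config.delay (cfg : Config J A Ω) (d : ℕ) : Config J A Ω :=
  { cfg with X := fun k => cfg.X (k + d) }

theorem emp_delay [∀ j, DecidableEq (A j)] (cfg : Config J A Ω) (d l k : ℕ) (ω : Ω) :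
    emp (cfg.delay d).X l k ω = emp cfg.X (l + d) (k + d) ω := by
  funext a
  have hlen : k + d + 1 - (l + d) = k + 1 - l := by omega
  simp only [emp, Config.delay, hlen, ← Finset.map_add_right_Icc, Finset.sum_map,
    addRightEmbedding_apply]
  congr!

variable [∀ j, Fintype (A j)] [∀ j, DecidableEq (A j)]

/-- The drift-corrected statistic of the window `l, …, k`. -/
def windowStat (cfg : Config J A Ω) (k : ℕ) (ω : Ω) (l : ℕ) : ℝ :=
  ((k + 1 - l : ℕ) : ℝ) * (globalStat cfg.qj (emp cfg.X l k ω) - cfg.kappa)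

theorem windowStat_delay (cfg : Config J A Ω) (d k : ℕ) (ω : Ω) (l : ℕ) :
    windowStat (cfg.delay d) k ω l = windowStat cfg (k + d) ω (l + d) := by
  have hlen : k + d + 1 - (l + d) = k + 1 - l := by omega
  simp only [windowStat, emp_delay, hlen]
  rfl

/-- The window starts over which the CUSUM statistic is maximized. -/
def windowStarts (t k : ℕ) : Finset ℕ :=
  insert (k + 1) (Finset.Icc t (k + 1))

theorem windowStarts_nonempty (t k : ℕ) : (windowStarts t k).Nonempty :=
  Finset.insert_nonempty _ _

theorem mem_windowStarts {t k l : ℕ} :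
    l ∈ windowStarts t k ↔ l = k + 1 ∨ t ≤ l ∧ l ≤ k + 1 := by
  simp [windowStarts]

theorem Sgen_eq_sup' (cfg : Config J A Ω) (t k : ℕ) (ω : Ω) :
    Sgen cfg t k ω = (windowStarts t k).sup' (windowStarts_nonempty t k) (windowStat cfg k ω) :=
  rfl

theorem igen_isGreatest (cfg : Config J A Ω) (t k : ℕ) (ω : Ω) :
    IsGreatest {l | l ∈ windowStarts t k ∧ windowStat cfg k ω l = Sgen cfg t k ω}
      (igen cfg t k ω) := by
  have h := Finset.isGreatest_max' ((windowStarts t k).filter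
    (fun l => windowStat cfg k ω l = Sgen cfg t k ω)) (by
      obtain ⟨b, hb, hbe⟩ := Finset.exists_mem_eq_sup' (windowStarts_nonempty t k)
        (windowStat cfg k ω)
      exact ⟨b, Finset.mem_filter.2 ⟨hb, hbe.symm⟩⟩)
  rw [Finset.coe_filter] at h
  exact h

theorem Sgen_anti (cfg : Config J A Ω) {s t : ℕ} (hst : s ≤ t) (k : ℕ) (ω : Ω) :
    Sgen cfg t k ω ≤ Sgen cfg s k ω := by
  simp only [Sgen_eq_sup']
  refine Finset.sup'_mono _ (fun l hl => ?_) _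
  rw [mem_windowStarts] at hl ⊢
  omega

theorem Sgen_delay (cfg : Config J A Ω) (d t k : ℕ) (ω : Ω) :
    Sgen (cfg.delay d) t k ω = Sgen cfg (t + d) (k + d) ω := by
  simp only [Sgen_eq_sup']
  refine le_antisymm (Finset.sup'_le _ _ fun l hl => ?_) (Finset.sup'_le _ _ fun l hl => ?_)
  · rw [windowStat_delay]
    refine Finset.le_sup' (windowStat cfg (k + d) ω) ?_
    rw [mem_windowStarts] at hl ⊢
    omega
  · rw [mem_windowStarts] at hl
    obtain ⟨l, rfl⟩ := Nat.exists_eq_add_of_le' (show d ≤ l by omega)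
    rw [← windowStat_delay]
    refine Finset.le_sup' (windowStat (cfg.delay d) k ω) ?_
    rw [mem_windowStarts]
    omega

theorem igen_delay (cfg : Config J A Ω) (d t k : ℕ) (ω : Ω) :
    igen cfg (t + d) (k + d) ω = igen (cfg.delay d) t k ω + d := by
  refine (igen_isGreatest cfg (t + d) (k + d) ω).unique ?_
  obtain ⟨⟨hmem, heq⟩, hub⟩ := igen_isGreatest (cfg.delay d) t k ω
  rw [windowStat_delay, Sgen_delay] at heq
  refine ⟨⟨?_, heq⟩, fun l hl => ?_⟩
  · rw [mem_windowStarts] at hmem ⊢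
    omega
  · obtain ⟨hl, hle⟩ := hl
    rw [mem_windowStarts] at hl
    obtain ⟨l, rfl⟩ := Nat.exists_eq_add_of_le' (show d ≤ l by omega)
    rw [← windowStat_delay, ← Sgen_delay] at hle
    refine Nat.add_le_add_right (hub ⟨?_, hle⟩) d
    rw [mem_windowStarts]
    omega

theorem Dgen_delay (cfg : Config J A Ω) (d t k : ℕ) (ω : Ω) :
    Dgen (cfg.delay d) t k ω = Dgen cfg (t + d) (k + d) ω := by
  have hlen : k + d + 1 - (igen (cfg.delay d) t k ω + d)
      = k + 1 - igen (cfg.delay d) t k ω := by omega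
  simp only [Dgen, igen_delay, emp_delay, hlen]
  rfl

/-- The alarm raised by the first stage at time `k` is suppressed by the second stage. -/
def Suppressed (cfg : Config J A Ω) (k : ℕ) (ω : Ω) : Prop :=
  cfg.cS ≤ Sstat cfg k ω ∧ Dstat cfg k ω < cfg.cD (nstat cfg k ω)

theorem tau_add_two (cfg : Config J A Ω) (k : ℕ) (ω : Ω) :
    tau cfg (k + 2) ω = if Suppressed cfg (k + 1) ω then k + 2 else tau cfg (k + 1) ω := by
  by_cases h : Suppressed cfg (k + 1) ω
  · rw [if_pos h]
    exact if_pos h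
  · rw [if_neg h]
    exact if_neg h

theorem one_le_tau (cfg : Config J A Ω) (k : ℕ) (ω : Ω) : 1 ≤ tau cfg k ω := by
  induction k with
  | zero => exact le_rfl
  | succ k ih =>
    cases k with
    | zero => exact le_rfl
    | succ k =>
      rw [tau_add_two]
      split_ifs <;> omega

theorem tau_eq_one (cfg : Config J A Ω) (ω : Ω) (k : ℕ)
    (h : ∀ j, 1 ≤ j → j < k → ¬ cfg.cS ≤ Sstat cfg j ω) : tau cfg k ω = 1 := by
  induction k with
  | zero => rfl
  | succ k ih =>
    cases k with
    | zero => rfl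
    | succ k =>
      rw [tau_add_two, if_neg fun hs => h (k + 1) (by omega) (by omega) hs.1]
      exact ih fun j hj hjk => h j hj (by omega)

theorem stats_delay_of_tau (cfg : Config J A Ω) (d k : ℕ) (ω : Ω)
    (h : tau cfg (k + d) ω = tau (cfg.delay d) k ω + d) :
    Sstat (cfg.delay d) k ω = Sstat cfg (k + d) ω ∧
      Dstat (cfg.delay d) k ω = Dstat cfg (k + d) ω ∧
      nstat (cfg.delay d) k ω = nstat cfg (k + d) ω := by
  refine ⟨?_, ?_, ?_⟩
  · simp only [Sstat, h, Sgen_delay]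
  · change Dgen _ _ _ _ = Dgen _ _ _ _
    rw [h, Dgen_delay]
  · simp only [nstat, istat, h, igen_delay]
    omega

/-- After a reset at time `d + 1` the algorithm runs as if started on the delayed samples. -/
theorem tau_delay (cfg : Config J A Ω) (d : ℕ) (ω : Ω) (hd : tau cfg (d + 1) ω = d + 1)
    (k : ℕ) : tau cfg (k + 1 + d) ω = tau (cfg.delay d) (k + 1) ω + d := by
  induction k with
  | zero =>
    rw [zero_add, add_comm 1 d, hd]
    exact add_comm _ _
  | succ k ih =>
    obtain ⟨hS, hD, hn⟩ := stats_delay_of_tau cfg d (k + 1) ω ih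
    have hiff : Suppressed cfg (k + d + 1) ω ↔ Suppressed (cfg.delay d) (k + 1) ω := by
      unfold Suppressed
      rw [hS, hD, hn, show k + 1 + d = k + d + 1 by omega]
      rfl
    rw [show k + 1 + 1 + d = (k + d) + 2 by omega, tau_add_two, tau_add_two]
    simp only [hiff]
    split_ifs
    · omega
    · rw [← ih, show k + 1 + d = k + d + 1 by omega]

theorem exists_mem_eq_of_iInf_coe_ne_top {s : Set ℕ} (h : (⨅ k ∈ s, (k : ℕ∞)) ≠ ⊤) :
    ∃ k ∈ s, (⨅ k ∈ s, (k : ℕ∞)) = k := by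
  have hs : s.Nonempty := by
    by_contra hs
    rw [Set.not_nonempty_iff_eq_empty] at hs
    exact h (by simp [hs])
  exact ⟨sInf s, Nat.sInf_mem hs, (ENat.natCast_sInf hs).symm⟩

theorem tS_le (cfg : Config J A Ω) (ω : Ω) {k : ℕ} (hk : 1 ≤ k)
    (h : cfg.cS ≤ Sstat cfg k ω) : tS cfg ω ≤ k :=
  iInf₂_le k ⟨hk, h⟩

theorem tI_le (cfg : Config J A Ω) (ω : Ω) {k : ℕ} (hk : 1 ≤ k)
    (h : cfg.cS ≤ Sstat cfg k ω) (h' : cfg.cD (nstat cfg k ω) ≤ Dstat cfg k ω) :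
    tI cfg ω ≤ k :=
  iInf₂_le k ⟨hk, h, h'⟩

theorem tS_le_of_Sgen (cfg : Config J A Ω) (ω : Ω) {k : ℕ} (hk : 1 ≤ k)
    (h : cfg.cS ≤ Sgen cfg 1 k ω) : tS cfg ω ≤ k := by
  by_cases hj : ∃ j, 1 ≤ j ∧ j < k ∧ cfg.cS ≤ Sstat cfg j ω
  · obtain ⟨j, hj, hjk, hS⟩ := hj
    exact (tS_le cfg ω hj hS).trans (by exact_mod_cast hjk.le)
  · push Not at hj
    refine tS_le cfg ω hk ?_
    rw [Sstat, tau_eq_one cfg ω k fun j h1 h2 => not_le.2 (hj j h1 h2)]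
    exact h

/-- The first crossing time is at most that of the run started `d` samples later. -/
theorem tS_le_add_delay (cfg : Config J A Ω) (d : ℕ) (ω : Ω) :
    tS cfg ω ≤ d + tS (cfg.delay d) ω := by
  by_cases htop : tS (cfg.delay d) ω = ⊤
  · simp [htop]
  obtain ⟨m, ⟨hm, hS⟩, heq⟩ := exists_mem_eq_of_iInf_coe_ne_top htop
  have hle := tS_le_of_Sgen cfg ω (k := m + d) (by omega) (by
    have hS' : cfg.cS ≤ Sgen cfg (tau (cfg.delay d) m ω + d) (m + d) ω := by
      rw [← Sgen_delay]
      exact hS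
    refine hS'.trans (Sgen_anti cfg ?_ _ ω)
    have := one_le_tau (cfg.delay d) m ω
    omega)
  rw [show tS (cfg.delay d) ω = m from heq, add_comm]
  exact_mod_cast hle

/-- The test stops no later than its restart after the first crossing. -/
theorem tI_le_tS_add_delay (cfg : Config J A Ω) (ω : Ω) :
    tI cfg ω ≤ tS cfg ω + tI (cfg.delay (tS cfg ω).toNat) ω := by
  by_cases htop : tS cfg ω = ⊤
  · simp [htop]
  obtain ⟨m, ⟨hm, hS⟩, heq⟩ := exists_mem_eq_of_iInf_coe_ne_top htop
  have hm' : tS cfg ω = m := heq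
  rw [hm', ENat.toNat_natCast]
  by_cases hD : cfg.cD (nstat cfg m ω) ≤ Dstat cfg m ω
  · exact (tI_le cfg ω hm hS hD).trans le_self_add
  by_cases htop' : tI (cfg.delay m) ω = ⊤
  · simp [htop']
  obtain ⟨n, ⟨hn, hnS, hnD⟩, hneq⟩ := exists_mem_eq_of_iInf_coe_ne_top htop'
  have hreset : tau cfg (m + 1) ω = m + 1 := by
    obtain ⟨m, rfl⟩ := Nat.exists_eq_add_of_le' hm
    rw [tau_add_two, if_pos ⟨hS, not_le.1 hD⟩]
  obtain ⟨n, rfl⟩ := Nat.exists_eq_add_of_le' hn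
  obtain ⟨h1, h2, h3⟩ := stats_delay_of_tau cfg m (n + 1) ω (tau_delay cfg m ω hreset n)
  rw [h1] at hnS
  rw [h2, h3] at hnD
  have hle := tI_le cfg ω (k := n + 1 + m) (by omega) hnS hnD
  rw [show tI (cfg.delay m) ω = ((n + 1 : ℕ) : ℕ∞) from hneq, add_comm]
  exact_mod_cast hle

end QCD

open QCD

/-!
STATEMENT 6 (pathwise bounds, proof of Lemma 2): For a fixed (deterministic) realization
`x : ℕ → ∏_j A_j` of the observation sequence (the algorithm is run on the one-point
sample space `Unit`):

* for every `u ≥ 0`, `t_I ≤ t_S^{(u)} + t_I^{t_S^{(u)}+1}`;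
* for every `k` with `t_S^{(u)} < k ≤ t_S^{(u+1)}`, `t_S^{(u+1)} ≤ k + t_S^k - 1`;
* consequently, for `u* = inf {u : t_S^{(u)} ≥ t₁}`,
  `t_I ≤ t₁ - 1 + t_S^{t₁} + t_I^{t_S^{(u*)}+1}`.

Here `t_S^v`, `t_I^v` are the stopping times of the algorithm run on the shifted
sequence starting at `x v` (time `k` of the shifted run reads `x (k + v - 1)`), and
`t_S^{(u)}` is the `u`-th crossing time, characterized by `t_S^{(0)} = 0` and
`t_S^{(u+1)} = t_S^{(u)} + t_S^{t_S^{(u)}+1}`.  All stopping times take values in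
`ℕ∞ = ℕ ∪ {∞}` (with `∞` when the corresponding threshold is never crossed), and the
arithmetic (including subtraction) is the truncated arithmetic of `ℕ∞`.
-/
theorem stmt6 {J : ℕ} (hJ : 1 ≤ J) {A : Fin J → Type*}
    [∀ j, Fintype (A j)] [∀ j, DecidableEq (A j)] [∀ j, Nonempty (A j)]
    (x : ℕ → ∀ j, A j)
    (qj : ∀ j, (A j → ℝ) → ℝ) (κ cS : ℝ) (cD : ℕ → ℝ)
    (fstar : ℕ → ((∀ j, A j) → ℝ))
    (f0 : (∀ j, A j) → ℝ) (hf0 : IsPmf f0)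
    -- standing assumptions
    (Lj : Fin J → ℝ)
    (hconc : ∀ j, ConcaveOn ℝ {p : A j → ℝ | IsPmf p} (qj j))
    (hLip : ∀ j, ∀ p₁ p₂ : A j → ℝ, IsPmf p₁ → IsPmf p₂ →
      |qj j p₁ - qj j p₂| ≤ Lj j * ∑ a, |p₁ a - p₂ a|)
    (hκpos : 0 < κ) (hcS : 0 < cS) (hcD : ∀ n, 0 ≤ cD n)
    (hfstar : ∀ n : ℕ, 1 ≤ n →
      (∃ f, IsPmf f ∧ cS / n + κ ≤ globalStat qj f) →
        IsPmf (fstar n) ∧ cS / n + κ ≤ globalStat qj (fstar n) ∧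
          ∀ g, IsPmf g → cS / n + κ ≤ globalStat qj g →
            klReal (fstar n) f0 ≤ klReal g f0)
    -- `shift v` runs the algorithm on the samples starting at `x v`
    (shift : ℕ → Config J A Unit)
    (hshift : ∀ v, shift v = Config.mk (fun k _ => x (k + v - 1)) qj κ cS cD fstar)
    -- `tcross u = t_S^{(u)}`, the `u`-th crossing time of the first threshold
    (tcross : ℕ → ℕ∞)
    (htcross0 : tcross 0 = 0)
    (htcross : ∀ u : ℕ, tcross (u + 1) = tcross u + tS (shift ((tcross u).toNat + 1)) ())
    (t₁ : ℕ) (ht₁ : 1 ≤ t₁) :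
    -- (1)
    (∀ u : ℕ, tI (shift 1) () ≤ tcross u + tI (shift ((tcross u).toNat + 1)) ()) ∧
    -- (2)
    (∀ u : ℕ, ∀ k : ℕ, tcross u < (k : ℕ∞) → (k : ℕ∞) ≤ tcross (u + 1) →
      tcross (u + 1) ≤ (k : ℕ∞) + tS (shift k) () - 1) ∧
    -- (3)
    (tI (shift 1) () ≤ (t₁ : ℕ∞) - 1 + tS (shift t₁) () +
      tI (shift ((tcross (sInf {u : ℕ | (t₁ : ℕ∞) ≤ tcross u})).toNat + 1)) ()) := by
  have hdelay : ∀ v d, shift (v + d) = (shift v).delay d := by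
    intro v d
    simp only [hshift, Config.delay, Config.mk.injEq, and_true]
    funext k _
    rw [show k + (v + d) - 1 = k + d + v - 1 by omega]
  have hI : ∀ u : ℕ, tI (shift 1) () ≤ tcross u + tI (shift ((tcross u).toNat + 1)) () := by
    intro u
    induction u with
    | zero => simp [htcross0]
    | succ u ih =>
      by_cases htop : tcross (u + 1) = ⊤
      · simp [htop]
      have hstep := tI_le_tS_add_delay (shift ((tcross u).toNat + 1)) ()
      rw [← hdelay, Nat.add_right_comm] at hstep
      have hu := htcross u
      have htop' := htop
      rw [hu, ENat.add_eq_top, not_or] at htop'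
      refine ih.trans ?_
      rw [hu, ENat.toNat_add htop'.1 htop'.2, add_assoc]
      gcongr
  have hS : ∀ u k : ℕ, tcross u < (k : ℕ∞) →
      tcross (u + 1) ≤ (k : ℕ∞) + tS (shift k) () - 1 := by
    intro u k hlt
    obtain ⟨T, hT⟩ := ENat.ne_top_iff_exists.1 hlt.ne_top
    rw [← hT, Nat.cast_lt] at hlt
    obtain ⟨d, rfl⟩ := Nat.exists_eq_add_of_le (show T + 1 ≤ k from hlt)
    have hle := tS_le_add_delay (shift (T + 1)) d ()
    rw [htcross, ← hT, ENat.toNat_natCast, hdelay (T + 1)]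
    have hcancel : ((T + 1 + d : ℕ) : ℕ∞) + tS ((shift (T + 1)).delay d) () - 1
        = T + (d + tS ((shift (T + 1)).delay d) ()) := by
      rw [show ((T + 1 + d : ℕ) : ℕ∞) + tS ((shift (T + 1)).delay d) ()
        = T + (d + tS ((shift (T + 1)).delay d) ()) + 1 by push_cast; ring]
      exact (ENat.addLECancellable_of_ne_top ENat.one_ne_top).add_tsub_cancel_right
    rw [hcancel]
    gcongr
  refine ⟨hI, fun u k hlt _ => hS u k hlt, ?_⟩
  refine (hI (sInf {u : ℕ | (t₁ : ℕ∞) ≤ tcross u})).trans ?_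
  gcongr
  cases hu : sInf {u : ℕ | (t₁ : ℕ∞) ≤ tcross u} with
  | zero => simp [htcross0]
  | succ u =>
    have hlt : tcross u < t₁ := by
      by_contra hge
      have := Nat.sInf_le (s := {u : ℕ | (t₁ : ℕ∞) ≤ tcross u}) (not_lt.1 hge)
      omega
    refine (hS u t₁ hlt).trans (le_of_eq ?_)
    obtain ⟨s, rfl⟩ := Nat.exists_eq_add_of_le' ht₁
    have hone := ENat.addLECancellable_of_ne_top ENat.one_ne_top
    push_cast
    rw [add_right_comm, hone.add_tsub_cancel_right, hone.add_tsub_cancel_right]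
end
end

section
/- Let A be a nonempty finite alphabet, f_0 a pmf on A with f_0(a) > 0 for all a, and C a closed convex subset of the probability simplex P over A. Suppose f* ∈ C minimizes I(·‖f_0) over C, i.e. I(f*‖f_0) ≤ I(g‖f_0) for all g ∈ C. Then for every f ∈ C, I(f‖f_0) ≥ I(f‖f*) + I(f*‖f_0); in particular I(f‖f_0) ≥ I(f‖f*). -/
/-!
STATEMENT 13: Pythagorean theorem for relative entropy (information projection).
If `f₀` is a full-support pmf on a nonempty finite alphabet, `C` is a closed convex
subset of the probability simplex, and `f* ∈ C` minimizes `I(·‖f₀)` over `C`, then for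
every `f ∈ C`, `I(f‖f₀) ≥ I(f‖f*) + I(f*‖f₀)`; in particular `I(f‖f₀) ≥ I(f‖f*)`.

The KL divergence takes values in `ℝ≥0∞`, with `I(f‖g) = ⊤` when `f` is not absolutely
continuous w.r.t. `g`, and with the convention `0 · log 0 = 0` otherwise.
-/

open Finset
open scoped ENNReal

noncomputable section

/-- `p` is a probability mass function on the finite type `B`. -/
def IsPmf {B : Type*} [Fintype B] (p : B → ℝ) : Prop :=
  (∀ a, 0 ≤ p a) ∧ ∑ a, p a = 1

/-- Kullback-Leibler divergence on a finite alphabet, with values in `ℝ≥0∞`: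
`⊤` if `f` is not absolutely continuous w.r.t. `g`, and otherwise
`Σ_a f a * log (f a / g a)` (which is nonnegative whenever `f` and `g` are pmfs). -/
def klDivE {B : Type*} [Fintype B] (f g : B → ℝ) : ℝ≥0∞ :=
  if ∀ a, g a = 0 → f a = 0 then ENNReal.ofReal (∑ a, f a * Real.log (f a / g a)) else ⊤

/-- The Gibbs inequality for finite sums, in real form. -/
theorem sum_mul_log_div_nonneg {B : Type*} [Fintype B] {f g : B → ℝ}
    (hf : IsPmf f) (hg : IsPmf g) (hac : ∀ a, g a = 0 → f a = 0) :
    0 ≤ ∑ a, f a * Real.log (f a / g a) := by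
  have hterm : ∀ a, f a - g a ≤ f a * Real.log (f a / g a) := by
    intro a
    rcases (hf.1 a).eq_or_lt with h0 | hpos
    · simpa [← h0] using hg.1 a
    · have hgpos : 0 < g a := (hg.1 a).lt_of_ne fun h => hpos.ne' (hac a h.symm)
      have h := mul_le_mul_of_nonneg_left
        (Real.one_sub_inv_le_log_of_pos (div_pos hpos hgpos)) hpos.le
      rwa [inv_div, mul_sub, mul_one, mul_div_cancel₀ _ hpos.ne'] at h
  calc (0 : ℝ) = ∑ a, (f a - g a) := by rw [Finset.sum_sub_distrib, hf.2, hg.2, sub_self]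
    _ ≤ _ := Finset.sum_le_sum fun a _ => hterm a

theorem IsPmf.le_one {B : Type*} [Fintype B] {f : B → ℝ} (hf : IsPmf f) (a : B) : f a ≤ 1 :=
  hf.2 ▸ Finset.single_le_sum (fun b _ => hf.1 b) (Finset.mem_univ a)

theorem mul_log_div_eq {x y : ℝ} (h : y = 0 → x = 0) :
    x * Real.log (x / y) = x * (Real.log x - Real.log y) := by
  rcases eq_or_ne x 0 with rfl | hx
  · simp
  · rw [Real.log_div hx (mt h hx)]

/-- If `p` minimizes the divergence from `q` along the segment towards `f`, then it has divergence
at most the cross term of `f` with any interior point of the segment. -/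
theorem sum_le_sum_mul_log_segment {B : Type*} [Fintype B] {p q f : B → ℝ} {t : ℝ}
    (ht : 0 < t) (ht1 : t < 1) (hp : IsPmf p) (hf : IsPmf f)
    (hg : IsPmf ((1 - t) • p + t • f))
    (hmin : ∑ a, p a * (Real.log (p a) - Real.log (q a)) ≤
      ∑ a, ((1 - t) • p + t • f) a *
        (Real.log (((1 - t) • p + t • f) a) - Real.log (q a))) :
    ∑ a, p a * (Real.log (p a) - Real.log (q a)) ≤
      ∑ a, f a * (Real.log ((1 - t) * p a + t * f a) - Real.log (q a)) := by
  have hac : ∀ a, ((1 - t) • p + t • f) a = 0 → p a = 0 := by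
    intro a h
    simp only [Pi.add_apply, Pi.smul_apply, smul_eq_mul] at h
    nlinarith [hp.1 a, mul_nonneg ht.le (hf.1 a), mul_nonneg (sub_pos.2 ht1).le (hp.1 a)]
  have hgibbs := sum_mul_log_div_nonneg hp hg hac
  rw [Finset.sum_congr rfl fun a _ => mul_log_div_eq (hac a)] at hgibbs
  simp only [Pi.add_apply, Pi.smul_apply, smul_eq_mul] at hmin hgibbs
  have hsplit : ∑ a, ((1 - t) * p a + t * f a) *
        (Real.log ((1 - t) * p a + t * f a) - Real.log (q a)) =
      (1 - t) * (∑ a, p a * (Real.log (p a) - Real.log (q a)) -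
        ∑ a, p a * (Real.log (p a) - Real.log ((1 - t) * p a + t * f a))) +
      t * ∑ a, f a * (Real.log ((1 - t) * p a + t * f a) - Real.log (q a)) := by
    rw [← Finset.sum_sub_distrib, Finset.mul_sum, Finset.mul_sum, ← Finset.sum_add_distrib]
    exact Finset.sum_congr rfl fun a _ => by ring
  rw [hsplit] at hmin
  refine le_of_mul_le_mul_left ?_ ht
  nlinarith [mul_nonneg (sub_pos.2 ht1).le hgibbs]

/-- If the cross terms along the segment from `p` to `f` stay bounded below near `p`, then
`f` is absolutely continuous with respect to `p`. -/
theorem eq_zero_of_le_sum_mul_log_segment {B : Type*} [Fintype B] {p f q : B → ℝ} {c : ℝ}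
    (hp : IsPmf p) (hf : IsPmf f)
    (h : ∀ t : ℝ, 0 < t → t < 1 →
      c ≤ ∑ a, f a * (Real.log ((1 - t) * p a + t * f a) - Real.log (q a)))
    (b : B) (hb : p b = 0) : f b = 0 := by
  classical
  by_contra hne
  have hfb : 0 < f b := (hf.1 b).lt_of_ne' hne
  have hbound : ∀ t : ℝ, 0 < t → t < 1 →
      c + ∑ a, f a * Real.log (q a) ≤ f b * Real.log (t * f b) := by
    intro t ht ht1
    have hle := h t ht ht1
    simp only [mul_sub, Finset.sum_sub_distrib] at hle
    have hsum : ∑ a, f a * Real.log ((1 - t) * p a + t * f a) ≤ f b * Real.log (t * f b) := by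
      rw [← Finset.add_sum_erase _ _ (Finset.mem_univ b), hb, mul_zero, zero_add]
      refine add_le_of_nonpos_right (Finset.sum_nonpos fun a _ => ?_)
      refine mul_nonpos_of_nonneg_of_nonpos (hf.1 a) (Real.log_nonpos ?_ ?_)
      · nlinarith [mul_nonneg ht.le (hf.1 a), mul_nonneg (sub_pos.2 ht1).le (hp.1 a)]
      · nlinarith [mul_nonneg ht.le (sub_nonneg.2 (hf.le_one a)),
          mul_nonneg (sub_pos.2 ht1).le (sub_nonneg.2 (hp.le_one a))]
    linarith
  have hlim : Filter.Tendsto (fun t : ℝ => f b * (Real.log t + Real.log (f b)))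
      (nhdsWithin 0 (Set.Ioi 0)) Filter.atBot :=
    (Filter.tendsto_atBot_add_const_right _ _ Real.tendsto_log_nhdsGT_zero).const_mul_atBot hfb
  obtain ⟨t, hlt, ht, ht1⟩ := ((hlim.eventually_lt_atBot (c + ∑ a, f a * Real.log (q a))).and
    (Ioo_mem_nhdsGT (zero_lt_one' ℝ))).exists
  have := hbound t ht ht1
  rw [Real.log_mul ht.ne' hfb.ne'] at this
  linarith

theorem le_sum_mul_log_of_segment {B : Type*} [Fintype B] {p f q : B → ℝ} {c : ℝ}
    (hac : ∀ a, p a = 0 → f a = 0)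
    (h : ∀ t : ℝ, 0 < t → t < 1 →
      c ≤ ∑ a, f a * (Real.log ((1 - t) * p a + t * f a) - Real.log (q a))) :
    c ≤ ∑ a, f a * (Real.log (p a) - Real.log (q a)) := by
  have hlim : Filter.Tendsto
      (fun t : ℝ => ∑ a, f a * (Real.log ((1 - t) * p a + t * f a) - Real.log (q a)))
      (nhdsWithin 0 (Set.Ioi 0)) (nhds (∑ a, f a * (Real.log (p a) - Real.log (q a)))) := by
    refine tendsto_finsetSum _ fun a _ => ?_
    by_cases hpa : p a = 0
    · simp [hac a hpa]
    · have hcont : ContinuousAt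
          (fun t : ℝ => f a * (Real.log ((1 - t) * p a + t * f a) - Real.log (q a))) 0 :=
        continuousAt_const.mul
          ((ContinuousAt.log (by fun_prop) (by simpa using hpa)).sub continuousAt_const)
      simpa [ContinuousAt] using hcont.tendsto.mono_left nhdsWithin_le_nhds
  exact ge_of_tendsto hlim (Filter.mem_of_superset (Ioo_mem_nhdsGT (zero_lt_one' ℝ))
    fun t ht => h t ht.1 ht.2)

theorem stmt13 {A : Type*} [Fintype A] [Nonempty A]
    (f₀ : A → ℝ) (hf₀ : IsPmf f₀) (hfull : ∀ a, 0 < f₀ a)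
    (C : Set (A → ℝ)) (hCP : ∀ f ∈ C, IsPmf f)
    (hCclosed : IsClosed C) (hCconv : Convex ℝ C)
    (fstar : A → ℝ) (hfstarC : fstar ∈ C)
    (hmin : ∀ g ∈ C, klDivE fstar f₀ ≤ klDivE g f₀) :
    ∀ f ∈ C, klDivE f fstar + klDivE fstar f₀ ≤ klDivE f f₀ ∧
      klDivE f fstar ≤ klDivE f f₀ := by
  intro f hf
  have hp := hCP _ hfstarC
  have hfP := hCP _ hf
  have hac₀ : ∀ g : A → ℝ, ∀ a, f₀ a = 0 → g a = 0 := fun g a h => absurd h (hfull a).ne'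
  have hkl₀ : ∀ g : A → ℝ, klDivE g f₀ =
      ENNReal.ofReal (∑ a, g a * (Real.log (g a) - Real.log (f₀ a))) := by
    intro g
    rw [klDivE, if_pos (hac₀ g), Finset.sum_congr rfl fun a _ => mul_log_div_eq (hac₀ g a)]
  have hnonneg₀ : ∀ g ∈ C, 0 ≤ ∑ a, g a * (Real.log (g a) - Real.log (f₀ a)) := by
    intro g hg
    rw [← Finset.sum_congr rfl fun a _ => mul_log_div_eq (hac₀ g a)]
    exact sum_mul_log_div_nonneg (hCP g hg) hf₀ (hac₀ g)
  have hseg : ∀ t : ℝ, 0 < t → t < 1 →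
      ∑ a, fstar a * (Real.log (fstar a) - Real.log (f₀ a)) ≤
        ∑ a, f a * (Real.log ((1 - t) * fstar a + t * f a) - Real.log (f₀ a)) := by
    intro t ht ht1
    have hg : (1 - t) • fstar + t • f ∈ C :=
      hCconv hfstarC hf (sub_pos.2 ht1).le ht.le (by ring)
    refine sum_le_sum_mul_log_segment ht ht1 hp hfP (hCP _ hg) ?_
    have h := hmin _ hg
    rwa [hkl₀, hkl₀, ENNReal.ofReal_le_ofReal_iff (hnonneg₀ _ hg)] at h
  have hac := eq_zero_of_le_sum_mul_log_segment hp hfP hseg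
  have hcross := le_sum_mul_log_of_segment hac hseg
  have hmain : klDivE f fstar + klDivE fstar f₀ ≤ klDivE f f₀ := by
    rw [hkl₀, hkl₀, klDivE, if_pos hac,
      ← ENNReal.ofReal_add (sum_mul_log_div_nonneg hfP hp hac) (hnonneg₀ _ hfstarC)]
    refine ENNReal.ofReal_le_ofReal ?_
    rw [Finset.sum_congr rfl fun a _ => mul_log_div_eq (hac a)]
    simp only [mul_sub, Finset.sum_sub_distrib] at hcross ⊢
    linarith
  exact ⟨hmain, le_self_add.trans hmain⟩
end
end
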